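/- arXiv:0802.1872 — 3 statements merged into one kernel-verified Lean document; each statement's English description precedes it below -/
import Mathlib

section
/- Every finitely generated refinement monoid is primely generated. -/
/-- The algebraic preorder on a commutative monoid: `x ≤ y` iff `∃ z, y = x + z`. -/
def AlgLE {M : Type*} [AddCommMonoid M] (x y : M) : Prop := ∃ z, y = x + z

/-- A monoid is conical if `x + y = 0` implies `x = 0` and `y = 0`. -/
def IsConical (M : Type*) [AddCommMonoid M] : Prop := ∀ x y : M, x + y = 0 → x = 0 ∧ y = 0

/-- A refinement monoid: every equality `a + b = c + d` admits a refinement. -/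
def IsRefinement (M : Type*) [AddCommMonoid M] : Prop :=
  ∀ a b c d : M, a + b = c + d →
    ∃ x y z w : M, a = x + y ∧ b = z + w ∧ c = x + z ∧ d = y + w

/-- Separative: `a + a = a + b` and `b + b = a + b` imply `a = b`. -/
def IsSeparative (M : Type*) [AddCommMonoid M] : Prop :=
  ∀ a b : M, a + a = a + b → b + b = a + b → a = b

/-- A prime element: `p ≠ 0` and `p ≤ a + b` implies `p ≤ a` or `p ≤ b`
(algebraic preorder). -/
def IsPrimeElem {M : Type*} [AddCommMonoid M] (p : M) : Prop :=
  p ≠ 0 ∧ ∀ a b : M, AlgLE p (a + b) → AlgLE p a ∨ AlgLE p b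

/-- Primely generated: every element is a finite sum of prime elements. -/
def PrimelyGenerated (M : Type*) [AddCommMonoid M] : Prop :=
  ∀ x : M, ∃ l : Multiset M, (∀ p ∈ l, IsPrimeElem p) ∧ x = l.sum

/-- Antisymmetric: the algebraic preorder is a partial order. -/
def IsAntisymmetric (M : Type*) [AddCommMonoid M] : Prop :=
  ∀ x y : M, AlgLE x y → AlgLE y x → x = y

/-- A primitive monoid: an antisymmetric, primely generated refinement monoid. -/
def IsPrimitive (M : Type*) [AddCommMonoid M] : Prop :=
  IsAntisymmetric M ∧ PrimelyGenerated M ∧ IsRefinement M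

/-- In a finitely generated commutative monoid the strict part of the algebraic preorder is
well founded (a consequence of Dickson's lemma). -/
theorem wellFounded_strict_algLE {M : Type*} [AddCommMonoid M]
    (hfg : ∃ S : Finset M, AddSubmonoid.closure (S : Set M) = ⊤) :
    WellFounded fun x y : M => AlgLE x y ∧ ¬ AlgLE y x := by
  classical
  obtain ⟨S, hS⟩ := hfg
  let f : (S → ℕ) → M := fun n => ∑ s, n s • (s : M)
  have hf : ∀ x, ∃ n, f n = x := by
    intro x
    have hx : x ∈ AddSubmonoid.closure (S : Set M) := hS ▸ AddSubmonoid.mem_top x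
    induction hx using AddSubmonoid.closure_induction with
    | mem x hx =>
      refine ⟨Pi.single ⟨x, hx⟩ 1, ?_⟩
      simp only [f]
      rw [Finset.sum_eq_single ⟨x, hx⟩] <;> simp +contextual
    | zero => exact ⟨0, by simp [f]⟩
    | add x y _ _ hx hy =>
      obtain ⟨m, rfl⟩ := hx
      obtain ⟨n, rfl⟩ := hy
      exact ⟨m + n, by simp [f, add_smul, Finset.sum_add_distrib]⟩
  have hmono : ∀ m n, m ≤ n → AlgLE (f m) (f n) := by
    intro m n h
    refine ⟨f (n - m), ?_⟩
    simp only [f, ← Finset.sum_add_distrib, ← add_smul, Pi.sub_apply]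
    exact Finset.sum_congr rfl fun s _ => by rw [Nat.add_sub_cancel' (h s)]
  choose g hg using hf
  have htrans : ∀ x y z : M, AlgLE x y → AlgLE y z → AlgLE x z := by
    rintro x _ _ ⟨u, rfl⟩ ⟨v, rfl⟩
    exact ⟨u + v, add_assoc x u v⟩
  let P : Preorder M :=
    { le := AlgLE, le_refl := fun x => ⟨0, (add_zero x).symm⟩, le_trans := htrans }
  have hwqo : WellQuasiOrderedLE M := ⟨fun u => by
    obtain ⟨m, n, hmn, h⟩ := wellQuasiOrdered_le (fun i => g (u i))
    have h' := hmono _ _ h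
    rw [hg, hg] at h'
    exact ⟨m, n, hmn, h'⟩⟩
  exact (inferInstance : WellFoundedLT M).wf

/-- A refinement monoid whose strict algebraic preorder is well founded is primely generated. -/
theorem IsRefinement.primelyGenerated {M : Type*} [AddCommMonoid M] (href : IsRefinement M)
    (hwf : WellFounded fun x y : M => AlgLE x y ∧ ¬ AlgLE y x) : PrimelyGenerated M := by
  intro x
  induction x using hwf.induction with
  | _ a ih =>
  by_cases ha : a = 0
  · exact ⟨0, by simp, by simpa using ha⟩
  by_cases hp : IsPrimeElem a
  · exact ⟨{a}, by simpa using hp, by simp⟩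
  by_contra hno
  refine hp ⟨ha, ?_⟩
  rintro b c ⟨d, hd⟩
  obtain ⟨x, y, z, w, hxy, -, hb, hc⟩ := href a d b c hd.symm
  by_cases hx : AlgLE a x
  · obtain ⟨u, hu⟩ := hx
    exact Or.inl ⟨u + z, by rw [hb, hu, add_assoc]⟩
  by_cases hy : AlgLE a y
  · obtain ⟨u, hu⟩ := hy
    exact Or.inr ⟨u + w, by rw [hc, hu, add_assoc]⟩
  obtain ⟨l, hl, hlx⟩ := ih x ⟨⟨y, hxy⟩, hx⟩
  obtain ⟨k, hk, hky⟩ := ih y ⟨⟨x, by rw [hxy, add_comm]⟩, hy⟩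
  refine absurd ⟨l + k, fun p hpm => ?_, ?_⟩ hno
  · exact (Multiset.mem_add.mp hpm).elim (hl p) (hk p)
  · rw [Multiset.sum_add, ← hlx, ← hky, hxy]

/-- Every finitely generated refinement monoid is primely generated. -/
theorem statement2 (M : Type*) [AddCommMonoid M]
    (hfg : ∃ S : Finset M, AddSubmonoid.closure (S : Set M) = ⊤)
    (href : IsRefinement M) :
    PrimelyGenerated M := by
  exact href.primelyGenerated (wellFounded_strict_algLE hfg)
end

section
/- Let M be a finitely generated primitive monoid. Then M is isomorphic to the graph monoid M(E) of some row-finite quiver E if and only if every free prime of M has at most one free lower cover in the set of primes of M partially ordered by the algebraic order. -/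
/-- A row-finite quiver: vertex set `V`, edge set `E`, source and range maps,
with each vertex emitting only finitely many edges. -/
structure RowFiniteQuiver where
  V : Type
  E : Type
  s : E → V
  r : E → V
  rowFinite : ∀ v : V, {e : E | s e = v}.Finite

/-- The defining relations of the graph monoid: each vertex `v` emitting at least
one edge is identified with `Σ_{s(e) = v} r(e)`.  (The free commutative monoid on
`V` is the monoid `Multiset V`.) -/
def graphRel (Q : RowFiniteQuiver) : Multiset Q.V → Multiset Q.V → Prop :=
  fun x y => ∃ v : Q.V, (∃ e : Q.E, Q.s e = v) ∧ x = {v} ∧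
    y = (Q.rowFinite v).toFinset.val.map Q.r

/-- The graph monoid `M(E)`: quotient of the free commutative monoid on the
vertices by the smallest monoid congruence containing the graph relations. -/
abbrev GraphMonoid (Q : RowFiniteQuiver) := (addConGen (graphRel Q)).Quotient

/-- Strict algebraic order. -/
def AlgLT {M : Type*} [AddCommMonoid M] (x y : M) : Prop := AlgLE x y ∧ x ≠ y

/-- `q` is a lower cover of `p` in the poset of primes of `M` (with the algebraic
order): `q < p` are primes and no prime lies strictly between them. -/
def IsPrimeLowerCover {M : Type*} [AddCommMonoid M] (q p : M) : Prop :=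
  IsPrimeElem q ∧ IsPrimeElem p ∧ AlgLT q p ∧
    ¬ ∃ r : M, IsPrimeElem r ∧ AlgLT q r ∧ AlgLT r p

/-- A prime `p` is free if `p + p ≠ p`. -/
def IsFreePrime {M : Type*} [AddCommMonoid M] (p : M) : Prop :=
  IsPrimeElem p ∧ p + p ≠ p

open Relation

section AlgebraicOrder

variable {M : Type*} [AddCommMonoid M]

theorem AlgLE.refl (x : M) : AlgLE x x := ⟨0, by simp⟩

theorem AlgLE.trans {x y z : M} (h : AlgLE x y) (h' : AlgLE y z) : AlgLE x z := by
  obtain ⟨a, rfl⟩ := h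
  obtain ⟨b, rfl⟩ := h'
  exact ⟨a + b, add_assoc _ _ _⟩

theorem AlgLE.add_right (x y : M) : AlgLE x (x + y) := ⟨y, rfl⟩

theorem AlgLE.add_left (x y : M) : AlgLE x (y + x) := ⟨y, add_comm _ _⟩

theorem AlgLE.of_mem_sum {l : Multiset M} {q : M} (h : q ∈ l) : AlgLE q l.sum := by
  obtain ⟨t, rfl⟩ := Multiset.exists_cons_of_mem h
  exact ⟨t.sum, by simp⟩

theorem AlgLE.nsmul_of_ne_zero (p : M) {k : ℕ} (hk : k ≠ 0) : AlgLE p (k • p) := by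
  obtain ⟨k, rfl⟩ := Nat.exists_eq_succ_of_ne_zero hk
  exact ⟨k • p, succ_nsmul' p k⟩

theorem AlgLE.of_absorbs {p q : M} (h : p + q = p) : AlgLE q p := ⟨p, by rw [add_comm, h]⟩

/-- If `p` absorbs every member of `l`, then it absorbs the sum. -/
theorem absorbs_sum {p : M} {l : Multiset M} (h : ∀ q ∈ l, p + q = p) : p + l.sum = p := by
  induction l using Multiset.induction with
  | empty => simp
  | cons a l ih =>
    rw [Multiset.sum_cons, ← add_assoc, h a (by simp), ih fun q hq => h q (by simp [hq])]

/-- What is absorbed by an element is absorbed by every larger one. -/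
theorem AlgLE.absorbs {x y z : M} (h : AlgLE x y) (hz : x + z = x) : y + z = y := by
  obtain ⟨t, rfl⟩ := h
  rw [add_right_comm, hz]

theorem absorbs_nsmul_add {p a : M} (h : p + a = p) {k : ℕ} (hk : k ≠ 0) :
    k • p + a = k • p :=
  (AlgLE.nsmul_of_ne_zero p hk).absorbs h

theorem IsPrimeElem.not_le_zero {p : M} (anti : IsAntisymmetric M) (hp : IsPrimeElem p) :
    ¬ AlgLE p 0 := fun h =>
  hp.1 (anti p 0 h ⟨p, by simp⟩)

theorem IsPrimeElem.exists_le_of_le_sum {p : M} (anti : IsAntisymmetric M) (hp : IsPrimeElem p)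
    {l : Multiset M} (h : AlgLE p l.sum) : ∃ q ∈ l, AlgLE p q := by
  induction l using Multiset.induction with
  | empty => exact absurd h (hp.not_le_zero anti)
  | cons a l ih =>
    rw [Multiset.sum_cons] at h
    rcases hp.2 _ _ h with h | h
    · exact ⟨a, by simp, h⟩
    · obtain ⟨q, hq, h⟩ := ih h
      exact ⟨q, by simp [hq], h⟩

theorem IsPrimeElem.absorbs_of_lt {p q : M} (anti : IsAntisymmetric M) (hp : IsPrimeElem p)
    (h : AlgLT q p) : p + q = p := by
  obtain ⟨hle, hne⟩ := h
  obtain ⟨z, hz⟩ := id hle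
  rcases hp.2 q z (hz ▸ AlgLE.refl p) with h | ⟨t, rfl⟩
  · exact absurd (anti _ _ hle h) hne
  · refine anti _ _ ⟨t, ?_⟩ (AlgLE.add_right _ _)
    nth_rw 1 [hz]
    abel

/-- Summands of multiples of a prime `p` are multiples of `p` up to absorbed elements. -/
theorem IsPrimeElem.exists_nsmul_add_of_le_nsmul {p x : M} {n : ℕ} (anti : IsAntisymmetric M)
    (pg : PrimelyGenerated M) (hp : IsPrimeElem p) (h : AlgLE x (n • p)) :
    ∃ (k : ℕ) (a : M), x = k • p + a ∧ p + a = p ∧ ¬ AlgLE p a := by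
  obtain ⟨l, hl, rfl⟩ := pg x
  have hle : ∀ r ∈ l, AlgLE r p := by
    intro r hr
    have h1 : AlgLE r (Multiset.replicate n p).sum := by
      rw [Multiset.sum_replicate]
      exact (AlgLE.of_mem_sum hr).trans h
    obtain ⟨q, hq, h2⟩ := (hl r hr).exists_le_of_le_sum anti h1
    rwa [Multiset.eq_of_mem_replicate hq] at h2
  clear h
  induction l using Multiset.induction with
  | empty => exact ⟨0, 0, by simp, by simp, hp.not_le_zero anti⟩
  | cons r l ih =>
    obtain ⟨k, a, h1, h2, h3⟩ := ih (fun q hq => hl q (by simp [hq])) fun q hq =>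
      hle q (by simp [hq])
    by_cases hr : r = p
    · subst hr
      exact ⟨k + 1, a, by rw [Multiset.sum_cons, h1, succ_nsmul']; abel, h2, h3⟩
    · have hrp : AlgLE r p := hle r (by simp)
      refine ⟨k, a + r, by rw [Multiset.sum_cons, h1]; abel, ?_, fun h => ?_⟩
      · rw [← add_assoc, h2, hp.absorbs_of_lt anti ⟨hrp, hr⟩]
      · exact (hp.2 _ _ h).elim h3 fun h => hr (anti _ _ hrp h)

theorem nsmul_eq_of_eq_nsmul_add {p a : M} {c k : ℕ}
    (h : c • p = k • p + a) (ha : p + a = p) (hpa : ¬ AlgLE p a) (hc : c ≠ 0) :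
    c • p = k • p := by
  rcases eq_or_ne k 0 with rfl | hk
  · rw [zero_nsmul, zero_add] at h
    exact absurd (h ▸ AlgLE.nsmul_of_ne_zero p hc) hpa
  · rw [h, absorbs_nsmul_add ha hk]

theorem nsmul_eq_succ_nsmul {p : M} (anti : IsAntisymmetric M) {i j : ℕ} (hij : i < j)
    (h : i • p = j • p) : i • p = (i + 1) • p := by
  refine anti _ _ ⟨p, succ_nsmul p i⟩ ⟨(j - (i + 1)) • p, ?_⟩
  rw [h, ← add_nsmul]
  congr 1
  omega

theorem IsFreePrime.nsmul_ne_succ_nsmul {p : M} (hM : IsPrimitive M) (hp : IsFreePrime p)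
    (n : ℕ) : n • p ≠ (n + 1) • p := by
  obtain ⟨anti, pg, ref⟩ := hM
  obtain ⟨hp, hfree⟩ := hp
  induction n using Nat.strong_induction_on with
  | _ n min =>
  intro hn
  have inj : ∀ i j, i < n → i • p = j • p → i = j := by
    intro i j hi h
    rcases lt_trichotomy i j with hij | rfl | hij
    · exact absurd (nsmul_eq_succ_nsmul anti hij h) (min i hi)
    · rfl
    · exact absurd (nsmul_eq_succ_nsmul anti hij h.symm) (min j (hij.trans hi))
  rcases Nat.lt_or_ge n 2 with h2 | h2
  · interval_cases n
    · exact hp.1 (by simpa using hn.symm)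
    · exact hfree (by simpa [two_nsmul] using hn.symm)
  · have e : p + n • p = p + (n - 1) • p := by
      rw [← succ_nsmul', ← succ_nsmul', ← hn]
      congr 1
      omega
    obtain ⟨x, y, z, w, h1, h3, h4, h5⟩ := ref _ _ _ _ e
    obtain ⟨kx, x, rfl, hx, hx'⟩ := hp.exists_nsmul_add_of_le_nsmul (x := x) (n := 1) anti pg
      ⟨y, by rw [← h1, one_nsmul]⟩
    obtain ⟨ky, y, rfl, hy, hy'⟩ := hp.exists_nsmul_add_of_le_nsmul (x := y) (n := n - 1) anti pg
      ⟨w, h5⟩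
    obtain ⟨kz, z, rfl, hz, hz'⟩ := hp.exists_nsmul_add_of_le_nsmul (x := z) (n := n) anti pg
      ⟨w, h3⟩
    obtain ⟨kw, w, rfl, hw, hw'⟩ := hp.exists_nsmul_add_of_le_nsmul (x := w) (n := n) anti pg
      ⟨kz • p + z, by rw [h3]; abel⟩
    have key : ∀ {c k k' : ℕ} {a a' : M}, c • p = (k • p + a) + (k' • p + a') → p + a = p →
        p + a' = p → ¬ AlgLE p a → ¬ AlgLE p a' → c ≠ 0 → c • p = (k + k') • p := by
      intro c k k' a a' h ha ha' hpa hpa' hc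
      refine nsmul_eq_of_eq_nsmul_add (a := a + a') ?_ ?_ ?_ hc
      · rw [h, add_nsmul]; abel
      · rw [← add_assoc, ha, ha']
      · exact fun h => (hp.2 _ _ h).elim hpa hpa'
    have e1 := inj 1 _ (by omega) (key ((one_nsmul p).trans h1) hx hy hx' hy' one_ne_zero)
    have e2 := inj 1 _ (by omega) (key ((one_nsmul p).trans h4) hx hz hx' hz' one_ne_zero)
    have e3 := inj (n - 1) _ (by omega) (key h5 hy hw hy' hw' (by omega))
    have e4 := key h3 hz hw hz' hw' (by omega)
    have e5 := inj (n - 1) n (by omega) (by rw [e4]; congr 1; omega)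
    omega

theorem IsFreePrime.eq_of_nsmul_eq {p a : M} (hM : IsPrimitive M) (hp : IsFreePrime p)
    {c k : ℕ} (h : c • p = k • p + a) (ha : p + a = p) (hpa : ¬ AlgLE p a) : c = k := by
  have h' : c • p = k • p := by
    rcases eq_or_ne c 0 with rfl | hc
    · rcases eq_or_ne k 0 with rfl | hk
      · rfl
      · refine absurd (((AlgLE.nsmul_of_ne_zero p hk).trans (AlgLE.add_right _ a)).trans ?_)
          (hp.1.not_le_zero hM.1)
        rw [← h, zero_nsmul]
        exact AlgLE.refl 0
    · exact nsmul_eq_of_eq_nsmul_add h ha hpa hc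
  rcases lt_trichotomy c k with hck | rfl | hck
  · exact absurd (nsmul_eq_succ_nsmul hM.1 hck h') (hp.nsmul_ne_succ_nsmul hM _)
  · rfl
  · exact absurd (nsmul_eq_succ_nsmul hM.1 hck h'.symm) (hp.nsmul_ne_succ_nsmul hM _)

/-- The multiplicity of a free prime `p` in an element is well defined as soon as the
remaining part is not above `p`. -/
theorem IsFreePrime.multiplicity_unique {p x y : M} (hM : IsPrimitive M) (hp : IsFreePrime p)
    {n m : ℕ} (h : n • p + x = m • p + y) (hx : ¬ AlgLE p x) (hy : ¬ AlgLE p y) : n = m := by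
  obtain ⟨a, b, c, d, h1, rfl, h3, rfl⟩ := hM.2.2 _ _ _ _ h
  have zero : ∀ {k : ℕ} {u v t : M}, ¬ AlgLE p (u + t) → u = k • p + v → u = v := by
    intro k u v t hu huv
    rcases eq_or_ne k 0 with rfl | hk
    · simpa using huv
    · refine absurd ?_ hu
      rw [huv, add_assoc]
      exact (AlgLE.nsmul_of_ne_zero p hk).trans (AlgLE.add_right _ _)
  obtain ⟨k, a, rfl, ha, ha'⟩ := hp.1.exists_nsmul_add_of_le_nsmul hM.1 hM.2.1 ⟨b, h1⟩
  have key : ∀ {N : ℕ} {u t : M}, ¬ AlgLE p (u + t) → N • p = k • p + a + u → N = k := by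
    intro N u t hu hN
    obtain ⟨j, v, hj, hv, hv'⟩ := hp.1.exists_nsmul_add_of_le_nsmul hM.1 hM.2.1
      (x := u) (n := N) ⟨k • p + a, by rw [hN, add_comm]⟩
    obtain rfl : u = v := zero hu hj
    refine hp.eq_of_nsmul_eq hM (a := a + u) (by rw [hN, add_assoc]) (by rw [← add_assoc, ha, hv])
      fun h => (hp.1.2 _ _ h).elim ha' hv'
  rw [key hy h1, key hx h3]

open Classical in
theorem IsFreePrime.count_eq {p : M} (hM : IsPrimitive M) (hp : IsFreePrime p)
    {l m : Multiset M} (h : l.sum = m.sum) (hl : ∀ q ∈ l, AlgLE p q → q = p)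
    (hm : ∀ q ∈ m, AlgLE p q → q = p) : l.count p = m.count p := by
  have split : ∀ l : Multiset M, l.sum = l.count p • p + (l.filter (¬ · = p)).sum := by
    intro l
    conv_lhs => rw [← Multiset.filter_add_not (· = p) l]
    have hrep : l.filter (· = p) = Multiset.replicate (l.count p) p := by
      convert Multiset.filter_eq' l p
    rw [Multiset.sum_add, hrep, Multiset.sum_replicate]
  have rest : ∀ l : Multiset M, (∀ q ∈ l, AlgLE p q → q = p) →
      ¬ AlgLE p (l.filter (¬ · = p)).sum := by
    intro l hl hle
    obtain ⟨q, hq, hpq⟩ := hp.1.exists_le_of_le_sum hM.1 hle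
    rw [Multiset.mem_filter] at hq
    exact hq.2 (hl q hq.1 hpq)
  rw [split l, split m] at h
  exact hp.multiplicity_unique hM h (rest l hl) (rest m hm)

/-- A multiset none of whose members absorbs another one. -/
def IsReducedMultiset (l : Multiset M) : Prop :=
  ¬ ∃ (a b : M) (t : Multiset M), l = a ::ₘ b ::ₘ t ∧ a + b = a

theorem IsReducedMultiset.eq_of_le {l : Multiset M} (anti : IsAntisymmetric M)
    (hred : IsReducedMultiset l) (hl : ∀ p ∈ l, IsPrimeElem p) {p q : M} (hp : p ∈ l)
    (hq : q ∈ l) (h : AlgLE q p) : q = p := by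
  by_contra hne
  obtain ⟨t, rfl⟩ := Multiset.exists_cons_of_mem hp
  obtain ⟨t, rfl⟩ := Multiset.exists_cons_of_mem ((Multiset.mem_cons.1 hq).resolve_left hne)
  exact hred ⟨p, q, t, rfl, (hl p (by simp)).absorbs_of_lt anti ⟨h, hne⟩⟩

open Classical in
theorem IsReducedMultiset.count_le_one {l : Multiset M} (hred : IsReducedMultiset l) {p : M}
    (hp : p + p = p) : l.count p ≤ 1 := by
  by_contra! h
  obtain ⟨t, rfl⟩ := Multiset.le_iff_exists_add.1 (Multiset.le_count_iff_replicate_le.1 h)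
  exact hred ⟨p, p, t, by simp [Multiset.replicate_succ], hp⟩

theorem IsReducedMultiset.mem_of_sum_eq {l m : Multiset M} (anti : IsAntisymmetric M)
    (hred : IsReducedMultiset l) (hl : ∀ p ∈ l, IsPrimeElem p) (hm : ∀ p ∈ m, IsPrimeElem p)
    (h : l.sum = m.sum) {p : M} (hp : p ∈ l) : p ∈ m := by
  obtain ⟨q, hq, hpq⟩ := (hl p hp).exists_le_of_le_sum anti (h ▸ AlgLE.of_mem_sum hp)
  obtain ⟨p', hp', hqp⟩ := (hm q hq).exists_le_of_le_sum anti (h ▸ AlgLE.of_mem_sum hq)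
  obtain rfl := hred.eq_of_le anti hl hp' hp (hpq.trans hqp)
  rwa [anti _ _ hpq hqp]

/-- An element of a primitive monoid has only one reduced decomposition into primes. -/
theorem IsReducedMultiset.eq_of_sum_eq {l m : Multiset M} (hM : IsPrimitive M)
    (hlred : IsReducedMultiset l) (hmred : IsReducedMultiset m)
    (hl : ∀ p ∈ l, IsPrimeElem p) (hm : ∀ p ∈ m, IsPrimeElem p) (h : l.sum = m.sum) :
    l = m := by
  classical
  have hiff : ∀ p, p ∈ l ↔ p ∈ m := fun p =>
    ⟨hlred.mem_of_sum_eq hM.1 hl hm h, hmred.mem_of_sum_eq hM.1 hm hl h.symm⟩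
  ext p
  by_cases hp : p ∈ l
  · by_cases hreg : p + p = p
    · have h1 := hlred.count_le_one hreg
      have h2 := hmred.count_le_one hreg
      have h3 := Multiset.count_pos.2 hp
      have h4 := Multiset.count_pos.2 ((hiff p).1 hp)
      omega
    · exact IsFreePrime.count_eq hM ⟨hl p hp, hreg⟩ h
        (fun q hq hpq => (hlred.eq_of_le hM.1 hl hq hp hpq).symm)
        (fun q hq hpq => (hmred.eq_of_le hM.1 hm hq ((hiff p).1 hp) hpq).symm)
  · rw [Multiset.count_eq_zero_of_notMem hp,
      Multiset.count_eq_zero_of_notMem fun h' => hp ((hiff p).2 h')]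

/-- A map on primes that preserves absorption extends to sums of primes: this is the
presentation of a primitive monoid by its primes and the relations `a + b = a`. -/
theorem IsPrimitive.sum_map_eq {N : Type*} [AddCommMonoid N] (hM : IsPrimitive M) (φ : M → N)
    (hφ : ∀ a b, IsPrimeElem a → IsPrimeElem b → a + b = a → φ a + φ b = φ a)
    {l m : Multiset M} (hl : ∀ p ∈ l, IsPrimeElem p) (hm : ∀ p ∈ m, IsPrimeElem p)
    (h : l.sum = m.sum) : (l.map φ).sum = (m.map φ).sum := by
  have red : ∀ (n : ℕ) (l : Multiset M), l.card = n → (∀ p ∈ l, IsPrimeElem p) →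
      ∃ l' : Multiset M, IsReducedMultiset l' ∧ (∀ p ∈ l', IsPrimeElem p) ∧
        l'.sum = l.sum ∧ (l'.map φ).sum = (l.map φ).sum := by
    intro n
    induction n with
    | zero =>
      rintro l hn hl
      obtain rfl := Multiset.card_eq_zero.1 hn
      exact ⟨0, by rintro ⟨a, b, t, h, -⟩; simp at h, hl, rfl, rfl⟩
    | succ n ih =>
      intro l hn hl
      by_cases hred : IsReducedMultiset l
      · exact ⟨l, hred, hl, rfl, rfl⟩
      obtain ⟨a, b, t, rfl, hab⟩ := not_not.1 hred
      obtain ⟨l', h1, h2, h3, h4⟩ := ih (a ::ₘ t) (by simpa using hn) fun p hp =>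
        hl p (by simp only [Multiset.mem_cons] at hp ⊢; tauto)
      refine ⟨l', h1, h2, ?_, ?_⟩
      · simp only [h3, Multiset.sum_cons, ← add_assoc, hab]
      · simp only [h4, Multiset.map_cons, Multiset.sum_cons, ← add_assoc,
          hφ a b (hl a (by simp)) (hl b (by simp)) hab]
  obtain ⟨l', hl1, hl2, hl3, hl4⟩ := red _ l rfl hl
  obtain ⟨m', hm1, hm2, hm3, hm4⟩ := red _ m rfl hm
  rw [← hl4, ← hm4, hl1.eq_of_sum_eq hM hm1 hl2 hm2 (by rw [hl3, hm3, h])]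

/-- A finitely generated antisymmetric monoid has finitely many primes. -/
theorem finite_setOf_isPrimeElem (anti : IsAntisymmetric M)
    (hfg : ∃ S : Finset M, AddSubmonoid.closure (S : Set M) = ⊤) :
    {p : M | IsPrimeElem p}.Finite := by
  obtain ⟨S, hS⟩ := hfg
  refine S.finite_toSet.subset fun p hp => ?_
  obtain ⟨l, hl, hsum⟩ := AddSubmonoid.exists_multiset_of_mem_closure
    (s := (S : Set M)) (x := p) (hS ▸ AddSubmonoid.mem_top p)
  obtain ⟨q, hq, hpq⟩ := IsPrimeElem.exists_le_of_le_sum anti hp (l := l)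
    (by rw [hsum]; exact AlgLE.refl p)
  rw [anti p q hpq (hsum ▸ AlgLE.of_mem_sum hq)]
  exact hl q hq

end AlgebraicOrder

section Rewriting

variable {V : Type*} (f : V → Multiset V)

/-- Replacing one vertex `v` by `f v`. -/
def RewriteStep (s t : Multiset V) : Prop := ∃ v u, s = v ::ₘ u ∧ t = f v + u

variable {f}

theorem RewriteStep.add_right {s t : Multiset V} (h : RewriteStep f s t) (u : Multiset V) :
    RewriteStep f (s + u) (t + u) := by
  obtain ⟨v, w, rfl, rfl⟩ := h
  exact ⟨v, w + u, by simp, by rw [add_assoc]⟩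

theorem RewriteStep.diamond {a b c : Multiset V} (hb : RewriteStep f a b)
    (hc : RewriteStep f a c) :
    ∃ d, ReflGen (RewriteStep f) b d ∧ ReflTransGen (RewriteStep f) c d := by
  obtain ⟨v, s, rfl, rfl⟩ := hb
  obtain ⟨w, t, h, rfl⟩ := hc
  rcases Multiset.cons_eq_cons.1 h with ⟨rfl, rfl⟩ | ⟨-, u, rfl, rfl⟩
  · exact ⟨_, .refl, .refl⟩
  · refine ⟨f v + (f w + u), .single ⟨w, f v + u, ?_, ?_⟩, .single ⟨v, f w + u, ?_, rfl⟩⟩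
    · rw [Multiset.add_cons]
    · rw [add_left_comm]
    · rw [Multiset.add_cons]

theorem reflTransGen_rewriteStep_add_right {s t : Multiset V}
    (h : ReflTransGen (RewriteStep f) s t) (u : Multiset V) :
    ReflTransGen (RewriteStep f) (s + u) (t + u) :=
  h.lift (· + u) fun _ _ h => h.add_right u

variable (f) in
/-- Having a common descendant under rewriting is a congruence. -/
def rewriteCon : AddCon (Multiset V) where
  r := Join (ReflTransGen (RewriteStep f))
  iseqv := equivalence_join_reflTransGen fun _ _ _ => RewriteStep.diamond
  add' := by
    rintro a b c d ⟨x, hax, hbx⟩ ⟨y, hcy, hdy⟩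
    refine ⟨x + y, (reflTransGen_rewriteStep_add_right hax c).trans ?_,
      (reflTransGen_rewriteStep_add_right hbx d).trans ?_⟩
    · simpa only [add_comm x] using reflTransGen_rewriteStep_add_right hcy x
    · simpa only [add_comm x] using reflTransGen_rewriteStep_add_right hdy x

end Rewriting

section GraphMonoid

open Classical in
/-- The targets of the edges leaving `v`, where a sink is its own target. -/
noncomputable def RowFiniteQuiver.targets (Q : RowFiniteQuiver) (v : Q.V) : Multiset Q.V :=
  if ∃ e, Q.s e = v then (Q.rowFinite v).toFinset.val.map Q.r else {v}

theorem RowFiniteQuiver.coe_targets (Q : RowFiniteQuiver) (v : Q.V) :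
    ((Q.targets v : Multiset Q.V) : GraphMonoid Q) = (({v} : Multiset Q.V) : GraphMonoid Q) := by
  unfold RowFiniteQuiver.targets
  split_ifs with h
  · exact ((AddCon.eq _).2 (AddConGen.Rel.of _ _ ⟨v, h, rfl, rfl⟩)).symm
  · rfl

theorem RowFiniteQuiver.join_of_coe_eq (Q : RowFiniteQuiver) {s t : Multiset Q.V}
    (h : (s : GraphMonoid Q) = t) : Join (ReflTransGen (RewriteStep Q.targets)) s t := by
  have hle : addConGen (graphRel Q) ≤ rewriteCon Q.targets := by
    refine AddCon.addConGen_le.2 ?_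
    rintro x y ⟨v, hv, rfl, rfl⟩
    refine ⟨Q.targets v, .single ⟨v, 0, rfl, (add_zero _).symm⟩, ?_⟩
    rw [RowFiniteQuiver.targets, if_pos hv]
  exact hle ((AddCon.eq _).1 h)

theorem map_get_filter_fst_eq {V : Type*} (f : V → Multiset V) (v : V)
    (h : {e : Σ v, Fin (f v).toList.length | e.1 = v}.Finite) :
    h.toFinset.val.map (fun e => (f e.1).toList.get e.2) = f v := by
  have h' : h.toFinset = (Finset.univ : Finset (Fin (f v).toList.length)).map
      (Function.Embedding.sigmaMk (β := fun v => Fin (f v).toList.length) v) := by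
    ext ⟨w, i⟩
    simp only [Set.Finite.mem_toFinset, Set.mem_ofPred_eq, Finset.mem_map, Finset.mem_univ,
      true_and]
    constructor
    · rintro rfl
      exact ⟨i, rfl⟩
    · rintro ⟨j, hj⟩
      exact (congrArg Sigma.fst hj).symm
  rw [h', Finset.map_val, Multiset.map_map]
  change Finset.univ.val.map (f v).toList.get = f v
  rw [Fin.univ_val_map, List.ofFn_get, Multiset.coe_toList]

/-- The quiver with one edge from `v` to each member of `f v`. -/
noncomputable def RowFiniteQuiver.ofMultiset {V : Type} (f : V → Multiset V) :
    RowFiniteQuiver where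
  V := V
  E := Σ v, Fin (f v).toList.length
  s e := e.1
  r e := (f e.1).toList.get e.2
  rowFinite v := (Set.finite_range (Sigma.mk v)).subset (by rintro ⟨w, i⟩ rfl; exact ⟨i, rfl⟩)

theorem RowFiniteQuiver.graphRel_ofMultiset_iff {V : Type} {f : V → Multiset V}
    {x y : Multiset V} :
    graphRel (RowFiniteQuiver.ofMultiset f) x y ↔ ∃ v, f v ≠ 0 ∧ x = {v} ∧ y = f v := by
  have emits : ∀ v, (∃ e, (RowFiniteQuiver.ofMultiset f).s e = v) ↔ f v ≠ 0 := by
    intro v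
    constructor
    · rintro ⟨⟨w, i⟩, rfl⟩ h
      change f w = 0 at h
      have := i.2
      simp [h] at this
    · intro h
      have : 0 < (f v).toList.length := by simpa [Multiset.card_pos] using h
      exact ⟨⟨v, 0, this⟩, rfl⟩
  exact exists_congr fun v => and_congr (emits v) (and_congr Iff.rfl
    (Eq.congr_right (map_get_filter_fst_eq f v _)))

end GraphMonoid

section Multiplicity

variable {M : Type*} [AddCommMonoid M]

/-- Every prime below `x` lies strictly below `p`. -/
def StrictlyBelow (p x : M) : Prop := ∀ s, IsPrimeElem s → AlgLE s x → AlgLT s p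

theorem StrictlyBelow.zero (anti : IsAntisymmetric M) (p : M) : StrictlyBelow p 0 :=
  fun _ hs h => absurd h (hs.not_le_zero anti)

theorem StrictlyBelow.add {p x y : M} (hx : StrictlyBelow p x) (hy : StrictlyBelow p y) :
    StrictlyBelow p (x + y) := fun s hs h =>
  (hs.2 _ _ h).elim (hx s hs) (hy s hs)

theorem StrictlyBelow.not_le {p x : M} (hx : StrictlyBelow p x) (hp : IsPrimeElem p) :
    ¬ AlgLE p x := fun h => (hx p hp h).2 rfl

theorem StrictlyBelow.of_lt {p q : M} (anti : IsAntisymmetric M) (h : AlgLT q p) :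
    StrictlyBelow p q := fun s _ hsq =>
  ⟨hsq.trans h.1, by rintro rfl; exact h.2 (anti _ _ h.1 hsq)⟩

theorem IsPrimeLowerCover.eq_of_le {p q s x : M} (h : IsPrimeLowerCover q p)
    (hx : StrictlyBelow p x) (hs : IsPrimeElem s) (hsx : AlgLE s x) (hqs : AlgLE q s) :
    s = q := by
  by_contra hne
  exact h.2.2.2 ⟨s, hs, ⟨hqs, fun e => hne e.symm⟩, hx s hs hsx⟩

open Classical in
/-- The multiplicity of `q` in some decomposition of `x` into primes. -/
noncomputable def primeMultiplicity (pg : PrimelyGenerated M) (q x : M) : ℕ :=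
  (Classical.choose (pg x)).count q

variable {p q x y : M} (hM : IsPrimitive M) (hq : IsFreePrime q) (hqp : IsPrimeLowerCover q p)

include hq hqp

open Classical in
theorem primeMultiplicity_eq_count (hx : StrictlyBelow p x) {l : Multiset M}
    (hl : ∀ s ∈ l, IsPrimeElem s) (h : x = l.sum) :
    primeMultiplicity hM.2.1 q x = l.count q := by
  have hc := Classical.choose_spec (hM.2.1 x)
  refine hq.count_eq hM (hc.2.symm.trans h) (fun s hs => ?_) fun s hs => ?_
  · exact hqp.eq_of_le hx (hc.1 s hs) (by rw [hc.2]; exact AlgLE.of_mem_sum hs)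
  · exact hqp.eq_of_le hx (hl s hs) (by rw [h]; exact AlgLE.of_mem_sum hs)

theorem primeMultiplicity_add (hx : StrictlyBelow p x) (hy : StrictlyBelow p y) :
    primeMultiplicity hM.2.1 q (x + y) =
      primeMultiplicity hM.2.1 q x + primeMultiplicity hM.2.1 q y := by
  classical
  obtain ⟨l, hl, rfl⟩ := hM.2.1 x
  obtain ⟨m, hm, rfl⟩ := hM.2.1 y
  rw [primeMultiplicity_eq_count hM hq hqp hx hl rfl,
    primeMultiplicity_eq_count hM hq hqp hy hm rfl,
    primeMultiplicity_eq_count hM hq hqp (hx.add hy) (l := l + m)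
      (fun s hs => (Multiset.mem_add.1 hs).elim (hl s) (hm s)) (by rw [Multiset.sum_add]),
    Multiset.count_add]

theorem primeMultiplicity_self : primeMultiplicity hM.2.1 q q = 1 := by
  classical
  rw [primeMultiplicity_eq_count hM hq hqp (StrictlyBelow.of_lt hM.1 hqp.2.2.1) (l := {q})
    (by simpa using hq.1) (by simp)]
  simp

theorem primeMultiplicity_eq_zero {r : M} (hr : IsPrimeLowerCover r p) (hqr : q ≠ r) :
    primeMultiplicity hM.2.1 q r = 0 := by
  classical
  rw [primeMultiplicity_eq_count hM hq hqp (StrictlyBelow.of_lt hM.1 hr.2.2.1) (l := {r})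
    (by simpa using hr.1) (by simp)]
  simpa using hqr

end Multiplicity

section LowerCovers

variable {M : Type*} [AddCommMonoid M] {V : Type*} {f : V → Multiset V} {val : Multiset V →+ M}

theorem map_eq_sum_map_singleton (val : Multiset V →+ M) (s : Multiset V) :
    val s = (s.map fun v => val {v}).sum := by
  conv_lhs => rw [← Multiset.sum_map_singleton s]
  rw [map_multiset_sum, Multiset.map_map]
  rfl

/-- A vertex representing a free prime has exactly one target representing the same prime,
and the other targets represent smaller elements. -/
theorem IsFreePrime.exists_targets_eq_cons {p : M} (anti : IsAntisymmetric M)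
    (hp : IsFreePrime p) {v : V} (hf : val {v} = val (f v)) (hv : val {v} = p) :
    ∃ (v' : V) (Y : Multiset V), val {v'} = p ∧ f v = v' ::ₘ Y ∧ StrictlyBelow p (val Y) := by
  have hfp : val (f v) = p := hf.symm.trans hv
  obtain ⟨x, hx, hpx⟩ := hp.1.exists_le_of_le_sum anti (l := (f v).map fun v => val {v})
    (by rw [← map_eq_sum_map_singleton, hfp]; exact AlgLE.refl p)
  have hxp : AlgLE x p := by
    rw [← hfp, map_eq_sum_map_singleton]
    exact AlgLE.of_mem_sum hx
  obtain ⟨v', hv', rfl⟩ := Multiset.mem_map.1 hx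
  have hv'p : val {v'} = p := anti _ _ hxp hpx
  obtain ⟨Y, hY⟩ := Multiset.exists_cons_of_mem hv'
  have hpY : p = p + val Y := by
    conv_lhs => rw [← hfp, hY, ← Multiset.singleton_add, map_add, hv'p]
  refine ⟨v', Y, hv'p, hY, fun s hs hsY => ⟨hpY ▸ hsY.trans (AlgLE.add_left _ _), ?_⟩⟩
  rintro rfl
  obtain ⟨z, hz⟩ := hsY
  exact hp.2 (anti _ _ ⟨z, by rw [add_assoc, ← hz, ← hpY]⟩ (AlgLE.add_right _ _))

/-- If a path of vertices representing `p` is given, with `X i` the side terms split off at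
step `i`, rewriting only moves along the path. -/
theorem exists_of_reflTransGen_path {v : ℕ → V} {X : ℕ → Multiset V}
    (hval : ∀ u, val {u} = val (f u)) (hstep : ∀ i, f (v i) = v (i + 1) ::ₘ X i)
    {s t : Multiset V} (hst : ReflTransGen (RewriteStep f) s t) {z : M} {Y : Multiset V}
    (hs : s = v 0 ::ₘ Y) (hY : val Y = z) :
    ∃ (n : ℕ) (Y' : Multiset V), t = v n ::ₘ Y' ∧
      val Y' = ∑ j ∈ Finset.range n, val (X j) + z := by
  induction hst with
  | refl => exact ⟨0, Y, hs, by simpa using hY⟩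
  | tail _ h ih =>
    obtain ⟨n, Y', rfl, hY'⟩ := ih
    obtain ⟨u, d, h, rfl⟩ := h
    rcases Multiset.cons_eq_cons.1 h with ⟨rfl, rfl⟩ | ⟨-, c, rfl, rfl⟩
    · refine ⟨n + 1, X n + Y', by rw [hstep, Multiset.cons_add], ?_⟩
      rw [map_add, hY', Finset.sum_range_succ]
      abel
    · refine ⟨n, f u + c, by rw [Multiset.add_cons], ?_⟩
      rw [map_add, ← hval, ← map_add, Multiset.singleton_add, hY']

/-- If `p` absorbs a smaller element `q`, then a path of vertices representing `p` revisits a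
vertex, and the side terms split off in between add up to `q`. -/
theorem exists_revisit {p q : M} (anti : IsAntisymmetric M) (hp : IsPrimeElem p)
    (hval : ∀ u, val {u} = val (f u))
    (hjoin : ∀ s t, val s = val t → Join (ReflTransGen (RewriteStep f)) s t)
    (hsurj : Function.Surjective val) {v : ℕ → V} {X : ℕ → Multiset V}
    (hv : ∀ i, val {v i} = p) (hstep : ∀ i, f (v i) = v (i + 1) ::ₘ X i)
    (hX : ∀ i, StrictlyBelow p (val (X i))) (hq : StrictlyBelow p q) (hpq : p + q = p) :
    ∃ n m, v n = v m ∧ ∑ j ∈ Finset.range m, val (X j) =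
      ∑ j ∈ Finset.range n, val (X j) + q := by
  obtain ⟨Q, rfl⟩ := hsurj q
  have e : val (v 0 ::ₘ Q) = val {v 0} := by
    rw [← Multiset.singleton_add, map_add, hv, hpq]
  obtain ⟨t, h1, h2⟩ := hjoin _ _ e
  obtain ⟨n, Y, rfl, hY⟩ := exists_of_reflTransGen_path hval hstep h1 rfl rfl
  obtain ⟨m, Y', h, hY'⟩ := exists_of_reflTransGen_path hval hstep h2 (Y := 0) rfl rfl
  rw [map_zero, add_zero] at hY'
  have hbelow : StrictlyBelow p (val Y) := by
    rw [hY]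
    exact (Finset.sum_induction _ (StrictlyBelow p) (fun _ _ => StrictlyBelow.add)
      (StrictlyBelow.zero anti p) fun i _ => hX i).add hq
  rcases Multiset.cons_eq_cons.1 h with ⟨hnm, rfl⟩ | ⟨-, c, rfl, -⟩
  · exact ⟨n, m, hnm, by rw [← hY', hY]⟩
  · refine absurd ⟨val c, ?_⟩ (hbelow.not_le hp)
    rw [← Multiset.singleton_add, map_add, hv]

/-- Partial sums of eventually periodic sequences: an increment zero over one period
excludes a nonzero increment over another. -/
theorem not_period_increments {C : Type*} {g : C → C} {c : C} {a : C → ℕ} {n k n' k' : ℕ}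
    (hk' : k' ≠ 0) (h : g^[n + k] c = g^[n] c)
    (h' : g^[n' + k'] c = g^[n'] c)
    (hs : ∑ j ∈ Finset.range (n + k), a (g^[j] c) = ∑ j ∈ Finset.range n, a (g^[j] c) + 1)
    (hs' : ∑ j ∈ Finset.range (n' + k'), a (g^[j] c) = ∑ j ∈ Finset.range n', a (g^[j] c)) :
    False := by
  have shift : ∀ {n k : ℕ}, g^[n + k] c = g^[n] c → ∀ j, g^[n + j + k] c = g^[n + j] c := by
    intro n k h j
    rw [show n + j + k = j + (n + k) by omega, Function.iterate_add_apply, h,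
      ← Function.iterate_add_apply, add_comm]
  set S : ℕ → ℕ := fun i => ∑ j ∈ Finset.range i, a (g^[j] c) with hS
  have succ : ∀ i, S (i + 1) = S i + a (g^[i] c) := fun i => Finset.sum_range_succ _ _
  have mono : Monotone S := monotone_nat_of_le_succ fun i => by rw [succ]; omega
  have prop : ∀ {n k d : ℕ}, g^[n + k] c = g^[n] c → S (n + k) = S n + d →
      ∀ j, S (n + j + k) = S (n + j) + d := by
    intro n k d h hd j
    induction j with
    | zero => exact hd
    | succ j ih =>
      rw [show n + (j + 1) + k = n + j + k + 1 by omega, ← add_assoc n j 1, succ, succ,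
        shift h, ih]
      omega
  have const : ∀ j, S (n' + j) = S n' := by
    intro j
    induction j with
    | zero => rfl
    | succ j ih =>
      have h1 := prop (d := 0) h' hs' j
      have h2 : S (n' + (j + 1)) ≤ S (n' + j + k') := mono (by omega)
      have h3 : S (n' + j) ≤ S (n' + (j + 1)) := mono (by omega)
      omega
  have h1 := prop h hs n'
  have h2 := const n
  have h3 := const (n + k)
  rw [show n + n' + k = n' + (n + k) by omega, h3, add_comm n n', h2] at h1
  omega

/-- In a primitive monoid presented by equating each vertex with a sum of vertices, a free
prime has at most one free lower cover. -/
theorem IsFreePrime.lowerCover_unique (hM : IsPrimitive M)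
    (hval : ∀ u, val {u} = val (f u))
    (hjoin : ∀ s t, val s = val t → Join (ReflTransGen (RewriteStep f)) s t)
    (hsurj : Function.Surjective val) {p q r : M} (hp : IsFreePrime p) (hq : IsFreePrime q)
    (hqp : IsPrimeLowerCover q p) (hr : IsFreePrime r) (hrp : IsPrimeLowerCover r p) :
    q = r := by
  by_contra hne
  have anti := hM.1
  obtain ⟨v₀, hv₀⟩ : ∃ v, val {v} = p := by
    obtain ⟨s, rfl⟩ := hsurj p
    obtain ⟨x, hx, hpx⟩ := hp.1.exists_le_of_le_sum anti (l := s.map fun v => val {v})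
      (by rw [← map_eq_sum_map_singleton]; exact AlgLE.refl _)
    obtain ⟨v, hv, rfl⟩ := Multiset.mem_map.1 hx
    exact ⟨v, anti _ _ (by rw [map_eq_sum_map_singleton val s]; exact AlgLE.of_mem_sum hx) hpx⟩
  have next : ∀ v : {v // val {v} = p}, ∃ (v' : {v // val {v} = p}) (Y : Multiset V),
      f v = v'.1 ::ₘ Y ∧ StrictlyBelow p (val Y) := by
    rintro ⟨v, hv⟩
    obtain ⟨v', Y, h1, h2⟩ := hp.exists_targets_eq_cons anti (hval v) hv
    exact ⟨⟨v', h1⟩, Y, h2⟩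
  choose g X hf hX using next
  let c : {v // val {v} = p} := ⟨v₀, hv₀⟩
  have revisit : ∀ {q : M}, IsPrimeLowerCover q p → ∃ n m, g^[n] c = g^[m] c ∧
      ∑ j ∈ Finset.range m, val (X (g^[j] c)) =
        ∑ j ∈ Finset.range n, val (X (g^[j] c)) + q := by
    intro q hqp
    obtain ⟨n, m, h1, h2⟩ := exists_revisit anti hp.1 hval hjoin hsurj
      (v := fun i => (g^[i] c).1) (X := fun i => X (g^[i] c)) (fun i => (g^[i] c).2)
      (fun i => by rw [hf, Function.iterate_succ_apply']) (fun i => hX _)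
      (StrictlyBelow.of_lt anti hqp.2.2.1) (hp.1.absorbs_of_lt anti hqp.2.2.1)
    exact ⟨n, m, Subtype.ext h1, h2⟩
  have below : ∀ n, StrictlyBelow p (∑ j ∈ Finset.range n, val (X (g^[j] c))) := fun n =>
    Finset.sum_induction _ (StrictlyBelow p) (fun _ _ => StrictlyBelow.add)
      (StrictlyBelow.zero anti p) fun i _ => hX _
  have mult_sum : ∀ {q : M}, IsFreePrime q → IsPrimeLowerCover q p → ∀ n,
      primeMultiplicity hM.2.1 q (∑ j ∈ Finset.range n, val (X (g^[j] c))) =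
        ∑ j ∈ Finset.range n, primeMultiplicity hM.2.1 q (val (X (g^[j] c))) := by
    intro q hq hqp n
    induction n with
    | zero =>
      classical
      rw [Finset.sum_range_zero, primeMultiplicity_eq_count hM hq hqp
        (StrictlyBelow.zero anti p) (l := 0) (by simp) (by simp)]
      simp
    | succ n ih =>
      rw [Finset.sum_range_succ, Finset.sum_range_succ, ← ih,
        primeMultiplicity_add hM hq hqp (below n) (hX _)]
  have increment : ∀ {q r : M} {n m : ℕ}, IsFreePrime q → IsPrimeLowerCover q p →
      IsPrimeLowerCover r p →
      ∑ j ∈ Finset.range m, val (X (g^[j] c)) = ∑ j ∈ Finset.range n, val (X (g^[j] c)) + r →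
      ∑ j ∈ Finset.range m, primeMultiplicity hM.2.1 q (val (X (g^[j] c))) =
        ∑ j ∈ Finset.range n, primeMultiplicity hM.2.1 q (val (X (g^[j] c))) +
          primeMultiplicity hM.2.1 q r := by
    intro q r n m hq hqp hrp h
    rw [← mult_sum hq hqp, ← mult_sum hq hqp, h,
      primeMultiplicity_add hM hq hqp (below n) (StrictlyBelow.of_lt anti hrp.2.2.1)]
  have lt_of_increment : ∀ {q : M} {n m : ℕ},
      ∑ j ∈ Finset.range m, primeMultiplicity hM.2.1 q (val (X (g^[j] c))) =
        ∑ j ∈ Finset.range n, primeMultiplicity hM.2.1 q (val (X (g^[j] c))) + 1 → n < m := by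
    intro q n m h
    by_contra! hmn
    have := Finset.sum_le_sum_of_subset (f := fun j =>
      primeMultiplicity hM.2.1 q (val (X (g^[j] c)))) (Finset.range_mono hmn)
    omega
  obtain ⟨n, m, hnm, hsum⟩ := revisit hqp
  obtain ⟨n', m', hnm', hsum'⟩ := revisit hrp
  have h1 := increment hq hqp hqp hsum
  rw [primeMultiplicity_self hM hq hqp] at h1
  have h2 := increment hr hrp hrp hsum'
  rw [primeMultiplicity_self hM hr hrp] at h2
  have h3 := increment hq hqp hrp hsum'
  rw [primeMultiplicity_eq_zero hM hq hqp hrp hne, add_zero] at h3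
  obtain ⟨k, rfl⟩ := Nat.exists_eq_add_of_lt (lt_of_increment h1)
  obtain ⟨k', rfl⟩ := Nat.exists_eq_add_of_lt (lt_of_increment h2)
  exact not_period_increments (n := n) (k := k + 1) (k' := k' + 1)
    (a := fun v => primeMultiplicity hM.2.1 q (val (X v)))
    (Nat.succ_ne_zero k') hnm.symm hnm'.symm h1 h3

end LowerCovers

section Realization

/-- An infinite system of equations collapsing everything to a single idempotent that absorbs
all the terms `y n`. -/
theorem collapse_of_absorbing_system {N : Type*} [AddCommMonoid N] {a b y : ℕ → N}
    (ha : ∀ n, a n = a (n + 1) + b n) (hb : ∀ n, b n = b n + (a 0 + y n))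
    (zero : ∃ n, y n = 0) (hya : ∀ m, ∃ n, y n = a m) (hyb : ∀ m, ∃ n, y n = b m) :
    (∀ n, a 0 + y n = a 0) ∧ (∀ n, a n = a 0) ∧ ∀ n, b n = a 0 := by
  have hle : ∀ n, AlgLE (a n) (a 0) := by
    intro n
    induction n with
    | zero => exact AlgLE.refl _
    | succ n ih => exact AlgLE.trans ⟨b n, ha n⟩ ih
  have h1 : ∀ n, a 0 + (a 0 + y n) = a 0 := fun n =>
    AlgLE.absorbs (AlgLE.trans ⟨a (n + 1), by rw [add_comm, ← ha]⟩ (hle n)) (hb n).symm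
  have h2 : a 0 + a 0 = a 0 := by
    obtain ⟨n, hn⟩ := zero
    simpa [hn] using h1 n
  have h3 : ∀ n, a 0 + y n = a 0 := fun n => by
    conv_rhs => rw [← h1 n, ← add_assoc, h2]
  have h4 : ∀ n, b n = a 0 := by
    intro n
    obtain ⟨m, hm⟩ := hyb n
    rw [hb, h3, ← hm, add_comm, h3]
  refine ⟨h3, fun n => ?_, h4⟩
  obtain ⟨m, hm⟩ := hya (n + 1)
  rw [ha, h4, ← hm, add_comm, h3]

variable {M : Type*} [AddCommMonoid M]

theorem exists_isPrimeLowerCover_of_lt (anti : IsAntisymmetric M)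
    (hfin : {p : M | IsPrimeElem p}.Finite) {p q : M} (hp : IsPrimeElem p) (hq : IsPrimeElem q)
    (h : AlgLT q p) : ∃ r, IsPrimeLowerCover r p ∧ AlgLE q r := by
  let _ : PartialOrder M :=
    { le := AlgLE
      le_refl := AlgLE.refl
      le_trans := fun _ _ _ => AlgLE.trans
      le_antisymm := anti }
  have hfin' : {r | IsPrimeElem r ∧ AlgLT r p}.Finite := hfin.subset fun _ h => h.1
  obtain ⟨r, hqr, hr⟩ := hfin'.exists_le_maximal (a := q) ⟨hq, h⟩
  refine ⟨r, ⟨hr.prop.1, hp, hr.prop.2, ?_⟩, hqr⟩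
  rintro ⟨s, hs, hrs, hsp⟩
  exact hrs.2 (anti _ _ hrs.1 (hr.le_of_ge ⟨hs, hsp⟩ hrs.1))

/-- If every free prime has at most one free lower cover, then all absorption relations between
primes follow from those under regular primes and from one relation for each free prime. -/
theorem absorbs_of_lowerCovers {N : Type*} [AddCommMonoid N] (anti : IsAntisymmetric M)
    (hfin : {p : M | IsPrimeElem p}.Finite)
    (huniq : ∀ p : M, IsFreePrime p → ∀ q r : M, IsFreePrime q → IsPrimeLowerCover q p →
      IsFreePrime r → IsPrimeLowerCover r p → q = r)
    {φ : M → N} {L : M → Finset M}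
    (hL : ∀ p q, q ∈ L p ↔ IsPrimeElem q ∧ AlgLT q p ∧ (q + q = q ∨ IsPrimeLowerCover q p))
    (hreg : ∀ p q, IsPrimeElem p → IsPrimeElem q → p + p = p → AlgLE q p → φ p + φ q = φ p)
    (hfree : ∀ p, IsFreePrime p → φ p = φ p + ∑ q ∈ L p, φ q)
    {p q : M} (hp : IsPrimeElem p) (hq : IsPrimeElem q) (hpq : p + q = p) :
    φ p + φ q = φ p := by
  classical
  suffices ∀ n, ∀ p, IsPrimeElem p → {r ∈ hfin.toFinset | AlgLE r p}.card = n →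
      ∀ q, IsPrimeElem q → p + q = p → φ p + φ q = φ p from this _ p hp rfl q hq hpq
  intro n
  induction n using Nat.strong_induction_on with
  | _ n ih =>
  rintro p hp rfl q hq hpq
  by_cases hpp : p + p = p
  · exact hreg p q hp hq hpp (AlgLE.of_absorbs hpq)
  have hp' : IsFreePrime p := ⟨hp, hpp⟩
  have hregular : ∀ r ∈ L p, r + r = r → φ p + φ r = φ p := by
    intro r hr hrr
    rw [hfree p hp', ← Finset.add_sum_erase _ _ hr, add_comm (φ r), ← add_assoc, add_assoc,
      hreg r r ((hL p r).1 hr).1 ((hL p r).1 hr).1 hrr (AlgLE.refl r)]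
  have hmem : ∀ r ∈ L p, φ p + φ r = φ p := by
    intro r hr
    by_cases hrr : r + r = r
    · exact hregular r hr hrr
    have hr' := (hL p r).1 hr
    have hrest : φ p + ∑ s ∈ (L p).erase r, φ s = φ p := by
      refine absorbs_sum fun x hx => ?_
      obtain ⟨s, hs, rfl⟩ := Multiset.mem_map.1 hx
      rw [Finset.mem_val, Finset.mem_erase] at hs
      have hs' := (hL p s).1 hs.2
      refine hregular s hs.2 (by_contra fun hss => hs.1 ?_)
      exact huniq p hp' s r ⟨hs'.1, hss⟩ (hs'.2.2.resolve_left hss) ⟨hr'.1, hrr⟩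
        (hr'.2.2.resolve_left hrr)
    conv_rhs => rw [hfree p hp', ← Finset.add_sum_erase _ _ hr, add_left_comm, hrest, add_comm]
  have hlt : AlgLT q p := ⟨AlgLE.of_absorbs hpq, by rintro rfl; exact hpp hpq⟩
  obtain ⟨r, hr, hqr⟩ := exists_isPrimeLowerCover_of_lt anti hfin hp hq hlt
  have hpr := hmem r ((hL p r).2 ⟨hr.1, hr.2.2.1, Or.inr hr⟩)
  by_cases hqr' : q = r
  · rw [hqr', hpr]
  have hrq : φ r + φ q = φ r := by
    refine ih _ (Finset.card_lt_card ?_) r hr.1 rfl q hq (hr.1.absorbs_of_lt anti ⟨hqr, hqr'⟩)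
    refine Finset.ssubset_iff_subset_ne.2 ⟨fun s hs => ?_, fun e => ?_⟩
    · rw [Finset.mem_filter] at hs ⊢
      exact ⟨hs.1, hs.2.trans hr.2.2.1.1⟩
    · have : p ∈ {s ∈ hfin.toFinset | AlgLE s r} := by
        rw [e, Finset.mem_filter]
        exact ⟨hfin.mem_toFinset.2 hp, AlgLE.refl p⟩
      exact hr.2.2.1.2 (anti _ _ hr.2.2.1.1 (Finset.mem_filter.1 this).2)
  rw [← hpr, add_assoc, hrq]

/-- The class of a multiset of vertices in the graph monoid of `RowFiniteQuiver.ofMultiset f`. -/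
def RowFiniteQuiver.ofMultisetMk {V : Type} (f : V → Multiset V) :
    Multiset V →+ GraphMonoid (RowFiniteQuiver.ofMultiset f) :=
  AddCon.mk' _

theorem RowFiniteQuiver.ofMultisetMk_singleton {V : Type} {f : V → Multiset V} {v : V}
    (hv : f v ≠ 0) : ofMultisetMk f {v} = ofMultisetMk f (f v) :=
  (AddCon.eq _).2 (AddConGen.Rel.of _ _ (graphRel_ofMultiset_iff.2 ⟨v, hv, rfl, rfl⟩))

theorem RowFiniteQuiver.exists_ofMultisetMk_lift {V : Type} {f : V → Multiset V}
    (σ : Multiset V →+ M) (hσ : ∀ v, σ {v} = σ (f v)) :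
    ∃ ψ : GraphMonoid (RowFiniteQuiver.ofMultiset f) →+ M, ∀ s, ψ (ofMultisetMk f s) = σ s := by
  have hle : addConGen (graphRel (RowFiniteQuiver.ofMultiset f)) ≤ AddCon.ker σ := by
    refine AddCon.addConGen_le.2 fun x y h => ?_
    obtain ⟨v, -, rfl, rfl⟩ := graphRel_ofMultiset_iff.1 h
    exact hσ v
  exact ⟨AddCon.lift _ σ hle, fun _ => rfl⟩

/-- A criterion for a primitive monoid to be the graph monoid of a quiver whose vertices
represent primes. -/
theorem nonempty_addEquiv_graphMonoid_ofMultiset (hM : IsPrimitive M) {V : Type}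
    {f : V → Multiset V} {π : V → M} (hπ : ∀ v, IsPrimeElem (π v))
    (hπ' : ∀ p, IsPrimeElem p → ∃ v, π v = p) (hrel : ∀ v, π v = ((f v).map π).sum)
    {φ : M → GraphMonoid (RowFiniteQuiver.ofMultiset f)}
    (hφ : ∀ v, RowFiniteQuiver.ofMultisetMk f {v} = φ (π v))
    (habs : ∀ a b, IsPrimeElem a → IsPrimeElem b → a + b = a → φ a + φ b = φ a) :
    Nonempty (M ≃+ GraphMonoid (RowFiniteQuiver.ofMultiset f)) := by
  let σ : Multiset V →+ M := Multiset.sumAddMonoidHom.comp (Multiset.mapAddMonoidHom π)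
  have hσ : ∀ s, σ s = (s.map π).sum := fun _ => rfl
  obtain ⟨ψ, hψ⟩ := RowFiniteQuiver.exists_ofMultisetMk_lift (f := f) σ fun v => by
    rw [hσ, hσ, ← hrel, Multiset.map_singleton, Multiset.sum_singleton]
  have hsurj : Function.Surjective (RowFiniteQuiver.ofMultisetMk f) := AddCon.mk'_surjective
  have hmk : ∀ s, RowFiniteQuiver.ofMultisetMk f s = ((s.map π).map φ).sum := by
    intro s
    rw [Multiset.map_map, map_eq_sum_map_singleton]
    exact congrArg Multiset.sum (Multiset.map_congr rfl fun v _ => hφ v)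
  have hprime : ∀ s : Multiset V, ∀ p ∈ s.map π, IsPrimeElem p := by
    intro s p hp
    obtain ⟨v, -, rfl⟩ := Multiset.mem_map.1 hp
    exact hπ v
  refine ⟨(AddEquiv.ofBijective ψ ⟨fun x y => ?_, fun x => ?_⟩).symm⟩
  · obtain ⟨s, rfl⟩ := hsurj x
    obtain ⟨t, rfl⟩ := hsurj y
    rw [hψ, hψ, hmk, hmk]
    exact hM.sum_map_eq φ habs (hprime s) (hprime t)
  · obtain ⟨l, hl, rfl⟩ := hM.2.1 x
    choose g hg using hπ'
    refine ⟨RowFiniteQuiver.ofMultisetMk f (l.pmap g hl), ?_⟩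
    simp only [hψ, hσ, Multiset.map_pmap, hg, Multiset.pmap_eq_map, Multiset.map_id']

/-- The vertices of the realizing quiver: two sequences of vertices for each prime. -/
abbrev RealizationVertex (M : Type*) [AddCommMonoid M] : Type _ :=
  {p : M // IsPrimeElem p} × Bool × ℕ

open Classical in
/-- The targets in the realizing quiver. A regular prime carries the system of
`collapse_of_absorbing_system`, a free prime `p` the equation `p = p + ∑ q ∈ L p, q`. -/
noncomputable def realizationTargets (L : M → Finset M)
    (y : {p : M // IsPrimeElem p} → ℕ → Multiset (RealizationVertex M))
    (v : RealizationVertex M) : Multiset (RealizationVertex M) :=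
  if v.1.1 + v.1.1 = v.1.1 then
    cond v.2.1 ({v} + ({(v.1, false, 0)} + y v.1 v.2.2))
      ({(v.1, false, v.2.2 + 1)} + {(v.1, true, v.2.2)})
  else {(v.1, false, 0)} + ((L v.1.1).subtype IsPrimeElem).val.map fun q => (q, false, 0)

/-- A finitely generated primitive monoid whose free primes have at most one free lower cover
is a graph monoid. -/
theorem IsPrimitive.exists_addEquiv_graphMonoid {M : Type} [AddCommMonoid M]
    (hM : IsPrimitive M) (hfg : ∃ S : Finset M, AddSubmonoid.closure (S : Set M) = ⊤)
    (huniq : ∀ p : M, IsFreePrime p → ∀ q r : M, IsFreePrime q → IsPrimeLowerCover q p →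
      IsFreePrime r → IsPrimeLowerCover r p → q = r) :
    ∃ Q : RowFiniteQuiver, Nonempty (M ≃+ GraphMonoid Q) := by
  classical
  have anti := hM.1
  have hfin := finite_setOf_isPrimeElem anti hfg
  have : Finite {p : M // IsPrimeElem p} := hfin
  have hy : ∀ p : {p : M // IsPrimeElem p}, ∃ y : ℕ → Multiset (RealizationVertex M),
      {s | ∀ v ∈ s, AlgLE v.1.1 p.1} = Set.range y := fun p =>
    (Set.to_countable _).exists_eq_range ⟨0, by simp⟩
  choose y hy using hy
  have hy_mem : ∀ p n, ∀ v ∈ y p n, AlgLE v.1.1 p.1 := fun p n =>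
    (Set.ext_iff.1 (hy p) (y p n)).2 ⟨n, rfl⟩
  have hy_surj : ∀ p s, (∀ v ∈ s, AlgLE v.1.1 p.1) → ∃ n, y p n = s := fun p s =>
    (Set.ext_iff.1 (hy p) s).1
  let L : M → Finset M := fun p =>
    {q ∈ hfin.toFinset | AlgLT q p ∧ (q + q = q ∨ IsPrimeLowerCover q p)}
  have hL : ∀ p q, q ∈ L p ↔ IsPrimeElem q ∧ AlgLT q p ∧
      (q + q = q ∨ IsPrimeLowerCover q p) := by
    intro p q
    rw [Finset.mem_filter, hfin.mem_toFinset]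
    rfl
  let f := realizationTargets L y
  let η := RowFiniteQuiver.ofMultisetMk f
  let φ : M → GraphMonoid (RowFiniteQuiver.ofMultiset f) := fun p =>
    if h : IsPrimeElem p then η {(⟨p, h⟩, false, 0)} else 0
  have hφ : ∀ p : {p : M // IsPrimeElem p}, φ p.1 = η {(p, false, 0)} := fun p => dif_pos p.2
  have hf : ∀ v, f v ≠ 0 := by
    intro v h
    have := congrArg Multiset.card h
    simp only [f, realizationTargets] at this
    split_ifs at this <;> rcases v with ⟨p, _ | _, n⟩ <;> simp at this
  have hη : ∀ v, η {v} = η (f v) := fun v =>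
    RowFiniteQuiver.ofMultisetMk_singleton (hf v)
  have hreg : ∀ p : {p : M // IsPrimeElem p}, p.1 + p.1 = p.1 →
      (∀ s, (∀ v ∈ s, AlgLE v.1.1 p.1) → φ p + η s = φ p) ∧ ∀ b n, η {(p, b, n)} = φ p := by
    intro p hp
    obtain ⟨h1, h2, h3⟩ := collapse_of_absorbing_system (a := fun n => η {(p, false, n)})
      (b := fun n => η {(p, true, n)}) (y := fun n => η (y p n))
      (fun n => by
        conv_lhs => rw [hη]
        rw [← map_add]
        simp only [f, realizationTargets, if_pos hp, cond_false])
      (fun n => by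
        conv_lhs => rw [hη]
        rw [← map_add, ← map_add]
        simp only [f, realizationTargets, if_pos hp, cond_true])
      ((hy_surj p 0 (by simp)).imp fun n hn => by rw [hn, map_zero])
      (fun m => (hy_surj p {(p, false, m)} (by simpa using AlgLE.refl p.1)).imp
        fun n hn => by rw [hn])
      (fun m => (hy_surj p {(p, true, m)} (by simpa using AlgLE.refl p.1)).imp
        fun n hn => by rw [hn])
    rw [hφ]
    refine ⟨fun s hs => ?_, fun b n => ?_⟩
    · obtain ⟨n, rfl⟩ := hy_surj p s hs
      exact h1 n
    · cases b
      · exact h2 n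
      · exact h3 n
  have hfree : ∀ p : {p : M // IsPrimeElem p}, p.1 + p.1 ≠ p.1 → ∀ b n,
      η {(p, b, n)} = φ p + ∑ q ∈ L p, φ q := by
    intro p hp b n
    rw [hη]
    simp only [f, realizationTargets, if_neg hp]
    rw [map_add, hφ, map_eq_sum_map_singleton η (Multiset.map _ _), Multiset.map_map]
    refine congrArg _ (Eq.trans ?_ (Finset.sum_subtype_of_mem φ fun q hq => ((hL _ _).1 hq).1))
    exact congrArg Multiset.sum (Multiset.map_congr rfl fun q _ => (hφ q).symm)
  refine ⟨RowFiniteQuiver.ofMultiset f, nonempty_addEquiv_graphMonoid_ofMultiset hM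
    (π := fun v => v.1.1) (fun v => v.1.2) (fun p hp => ⟨(⟨p, hp⟩, false, 0), rfl⟩) ?_
    (φ := φ) ?_ ?_⟩
  · intro v
    simp only [f, realizationTargets]
    split_ifs with h
    · have habs : ∀ n, v.1.1 + ((y v.1 n).map fun v => v.1.1).sum = v.1.1 := fun n =>
        absorbs_sum fun q hq => by
          obtain ⟨w, hw, rfl⟩ := Multiset.mem_map.1 hq
          by_cases e : w.1.1 = v.1.1
          · rw [e, h]
          · exact v.1.2.absorbs_of_lt anti ⟨hy_mem _ _ w hw, e⟩
      rcases v with ⟨p, _ | _, n⟩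
      · simpa using h.symm
      · simp only [cond_true, Multiset.map_add, Multiset.map_singleton, Multiset.sum_add,
          Multiset.sum_singleton]
        rw [habs, h]
    · rw [Multiset.map_add, Multiset.sum_add, Multiset.map_singleton, Multiset.sum_singleton]
      refine (absorbs_sum fun q hq => ?_).symm
      rw [Multiset.map_map] at hq
      obtain ⟨r, hr, rfl⟩ := Multiset.mem_map.1 hq
      have hr' := (hL v.1.1 r.1).1 (Finset.mem_subtype.1 hr)
      exact v.1.2.absorbs_of_lt anti hr'.2.1
  · rintro ⟨p, b, n⟩
    by_cases hp : p.1 + p.1 = p.1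
    · exact (hreg p hp).2 b n
    · exact (hfree p hp b n).trans ((hfree p hp false 0).symm.trans (hφ p).symm)
  · intro a b ha hb hab
    refine absorbs_of_lowerCovers anti hfin huniq hL (fun p q hp hq hpp hqp => ?_)
      (fun p hp => ?_) ha hb hab
    · rw [hφ ⟨q, hq⟩]
      exact (hreg ⟨p, hp⟩ hpp).1 _ (by simpa using hqp)
    · rw [← hfree ⟨p, hp.1⟩ hp.2 false 0, ← hφ]

end Realization

/-- A finitely generated primitive monoid is (isomorphic to) a graph monoid of a
row-finite quiver iff every free prime has at most one free lower cover in the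
poset of primes. -/
theorem statement11 (M : Type) [AddCommMonoid M] (hprim : IsPrimitive M)
    (hfg : ∃ S : Finset M, AddSubmonoid.closure (S : Set M) = ⊤) :
    (∃ Q : RowFiniteQuiver, Nonempty (M ≃+ GraphMonoid Q)) ↔
    (∀ p : M, IsFreePrime p →
      ∀ q r : M, IsFreePrime q → IsPrimeLowerCover q p →
        IsFreePrime r → IsPrimeLowerCover r p → q = r) := by
  constructor
  · rintro ⟨Q, ⟨e⟩⟩ p hp q r hq hqp hr hrp
    let val : Multiset Q.V →+ M :=
      e.symm.toAddMonoidHom.comp (AddCon.mk' (addConGen (graphRel Q)))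
    refine hp.lowerCover_unique (f := Q.targets) (val := val) hprim (fun v => ?_)
      (fun s t h => Q.join_of_coe_eq (e.symm.injective h))
      (e.symm.surjective.comp AddCon.mk'_surjective) hq hqp hr hrp
    exact congrArg e.symm (Q.coe_targets v).symm
  · exact hprim.exists_addEquiv_graphMonoid hfg
end

section
/- Let M be the quotient of the free commutative monoid on three generators p, a, b by the smallest monoid congruence identifying p with p + a and p with p + b. Then M is a finitely generated primitive monoid that is not isomorphic to the graph monoid M(E) of any row-finite quiver E. -/
/-- The defining relations `p = p + a` and `p = p + b`, where the generators
`p, a, b` are the elements `0, 1, 2` of `Fin 3`.  (The free commutative monoid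
on the three generators is `Multiset (Fin 3)`.) -/
def rel12 : Multiset (Fin 3) → Multiset (Fin 3) → Prop := fun x y =>
  (x = ({0} : Multiset (Fin 3)) ∧ y = ({0} : Multiset (Fin 3)) + ({1} : Multiset (Fin 3))) ∨
  (x = ({0} : Multiset (Fin 3)) ∧ y = ({0} : Multiset (Fin 3)) + ({2} : Multiset (Fin 3)))

/-- The monoid `M = ⟨p, a, b ∣ p = p + a = p + b⟩`. -/
abbrev M12 := (addConGen rel12).Quotient

/-- The homomorphism out of the free commutative monoid on `α` extending `g`. -/
def multisetHom {α N : Type*} [AddCommMonoid N] (g : α → N) : Multiset α →+ N :=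
  Multiset.sumAddMonoidHom.comp (Multiset.mapAddMonoidHom g)

@[simp]
theorem multisetHom_singleton {α N : Type*} [AddCommMonoid N] (g : α → N) (v : α) :
    multisetHom g {v} = g v := by
  simp [multisetHom]

namespace M12

/-- The universal property of `M12`. -/
def lift {N : Type*} [AddCommMonoid N] (g : Fin 3 → N) (h₁ : g 0 = g 0 + g 1)
    (h₂ : g 0 = g 0 + g 2) : M12 →+ N :=
  (addConGen rel12).lift (multisetHom g) <| AddCon.addConGen_le.2 <| by
    rintro x y (⟨rfl, rfl⟩ | ⟨rfl, rfl⟩)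
    · rwa [AddCon.ker_rel, map_add, multisetHom_singleton, multisetHom_singleton]
    · rwa [AddCon.ker_rel, map_add, multisetHom_singleton, multisetHom_singleton]

/-- The class of the `i`-th generator. -/
def gen (i : Fin 3) : M12 := (({i} : Multiset (Fin 3)) : M12)

theorem lift_gen {N : Type*} [AddCommMonoid N] (g : Fin 3 → N) (h₁ : g 0 = g 0 + g 1)
    (h₂ : g 0 = g 0 + g 2) (i : Fin 3) : lift g h₁ h₂ (gen i) = g i :=
  multisetHom_singleton g i

theorem gen_zero_add_gen_one : gen 0 + gen 1 = gen 0 :=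
  ((addConGen rel12).eq.2 (AddConGen.Rel.of _ _ (Or.inl ⟨rfl, rfl⟩))).symm

theorem gen_zero_add_gen_two : gen 0 + gen 2 = gen 0 :=
  ((addConGen rel12).eq.2 (AddConGen.Rel.of _ _ (Or.inr ⟨rfl, rfl⟩))).symm

/-- The number of occurrences of `p`. -/
def level : M12 →+ ℕ := lift ![1, 0, 0] rfl rfl

theorem level_gen (i : Fin 3) : level (gen i) = ![1, 0, 0] i :=
  lift_gen _ _ _ i

/-- The numbers of occurrences of `a` and of `b`, which are infinite in the presence of `p`. -/
def coords : M12 →+ ℕ∞ × ℕ∞ := lift ![(⊤, ⊤), (1, 0), (0, 1)] (by simp) (by simp)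

theorem coords_gen (i : Fin 3) : coords (gen i) = ![(⊤, ⊤), (1, 0), (0, 1)] i :=
  lift_gen _ _ _ i

/-- The element `n p + i a + j b`. -/
def elt (n i j : ℕ) : M12 := n • gen 0 + i • gen 1 + j • gen 2

theorem elt_add (n i j n' i' j' : ℕ) :
    elt n i j + elt n' i' j' = elt (n + n') (i + i') (j + j') := by
  simp only [elt, add_smul]
  abel

theorem gen_zero_add_nsmul (i j : ℕ) : gen 0 + (i • gen 1 + j • gen 2) = gen 0 := by
  have h (c : M12) (hc : gen 0 + c = gen 0) (k : ℕ) : gen 0 + k • c = gen 0 := by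
    induction k with
    | zero => simp
    | succ k ih => rw [succ_nsmul, ← add_assoc, ih, hc]
  rw [← add_assoc, h _ gen_zero_add_gen_one, h _ gen_zero_add_gen_two]

theorem elt_succ (n i j : ℕ) : elt (n + 1) i j = elt (n + 1) 0 0 := by
  have h := gen_zero_add_nsmul i j
  simp only [elt, succ_nsmul, zero_nsmul, add_zero]
  rw [add_assoc, add_assoc, h]

@[simp]
theorem level_elt (n i j : ℕ) : level (elt n i j) = n := by
  simp [level_gen, elt]

theorem coords_elt_zero (i j : ℕ) : coords (elt 0 i j) = (↑i, ↑j) := by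
  simp [coords_gen, elt]

theorem elt_eq_iff {n i j n' i' j' : ℕ} :
    elt n i j = elt n' i' j' ↔ n = n' ∧ (n = 0 → i = i' ∧ j = j') := by
  constructor
  · intro h
    have hn : n = n' := by simpa using congrArg level h
    subst hn
    refine ⟨rfl, ?_⟩
    rintro rfl
    simpa [coords_elt_zero] using congrArg coords h
  · rintro ⟨rfl, h⟩
    cases n with
    | zero =>
      obtain ⟨rfl, rfl⟩ := h rfl
      rfl
    | succ n => rw [elt_succ, elt_succ n i' j']

theorem exists_elt (x : M12) : ∃ n i j, x = elt n i j := by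
  induction x using AddCon.induction_on with
  | H s =>
    induction s using Multiset.induction_on with
    | empty => exact ⟨0, 0, 0, by simp [elt]⟩
    | cons v s ih =>
      obtain ⟨n, i, j, h⟩ := ih
      have hs : ((v ::ₘ s : Multiset (Fin 3)) : M12) = gen v + elt n i j := by
        rw [← h, ← Multiset.singleton_add]
        rfl
      rw [hs]
      fin_cases v
      · exact ⟨n + 1, i, j, by simp only [elt, succ_nsmul, Fin.zero_eta]; abel⟩
      · exact ⟨n, i + 1, j, by simp only [elt, succ_nsmul, Fin.mk_one]; abel⟩
      · exact ⟨n, i, j + 1, by simp only [elt, succ_nsmul, Fin.reduceFinMk]; abel⟩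

theorem algLE_elt_iff {n i j n' i' j' : ℕ} :
    AlgLE (elt n i j) (elt n' i' j') ↔ n ≤ n' ∧ (n' = 0 → i ≤ i' ∧ j ≤ j') := by
  constructor
  · rintro ⟨z, hz⟩
    obtain ⟨k, l, m, rfl⟩ := exists_elt z
    rw [elt_add, elt_eq_iff] at hz
    omega
  · rintro h
    refine ⟨elt (n' - n) (i' - i) (j' - j), ?_⟩
    rw [elt_add, elt_eq_iff]
    omega

theorem gen_eq_elt (i : Fin 3) :
    gen i = elt (if i = 0 then 1 else 0) (if i = 1 then 1 else 0) (if i = 2 then 1 else 0) := by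
  fin_cases i <;> simp [elt]

theorem isPrimeElem_gen (i : Fin 3) : IsPrimeElem (gen i) := by
  have h0 : (0 : M12) = elt 0 0 0 := by simp [elt]
  constructor
  · rw [h0, gen_eq_elt, Ne, elt_eq_iff]
    fin_cases i <;> simp
  · intro x y
    obtain ⟨n, k, l, rfl⟩ := exists_elt x
    obtain ⟨n', k', l', rfl⟩ := exists_elt y
    rw [gen_eq_elt, elt_add, algLE_elt_iff, algLE_elt_iff, algLE_elt_iff]
    fin_cases i <;> simp <;> omega

theorem isAntisymmetric : IsAntisymmetric M12 := by
  intro x y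
  obtain ⟨n, i, j, rfl⟩ := exists_elt x
  obtain ⟨n', i', j', rfl⟩ := exists_elt y
  rw [algLE_elt_iff, algLE_elt_iff, elt_eq_iff]
  omega

theorem primelyGenerated : PrimelyGenerated M12 := by
  intro x
  obtain ⟨n, i, j, rfl⟩ := exists_elt x
  refine ⟨.replicate n (gen 0) + .replicate i (gen 1) + .replicate j (gen 2), ?_, by simp [elt]⟩
  intro p hp
  simp only [Multiset.mem_add, Multiset.mem_replicate] at hp
  obtain (⟨-, rfl⟩ | ⟨-, rfl⟩) | ⟨-, rfl⟩ := hp <;> exact isPrimeElem_gen _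

theorem isRefinement : IsRefinement M12 := by
  intro a b c d h
  obtain ⟨n₁, i₁, j₁, rfl⟩ := exists_elt a
  obtain ⟨n₂, i₂, j₂, rfl⟩ := exists_elt b
  obtain ⟨n₃, i₃, j₃, rfl⟩ := exists_elt c
  obtain ⟨n₄, i₄, j₄, rfl⟩ := exists_elt d
  rw [elt_add, elt_add, elt_eq_iff] at h
  have key (n₁₃ i₁₃ j₁₃ n₁₄ i₁₄ j₁₄ n₂₃ i₂₃ j₂₃ n₂₄ i₂₄ j₂₄ : ℕ)
      (h₁ : n₁ = n₁₃ + n₁₄ ∧ (n₁ = 0 → i₁ = i₁₃ + i₁₄ ∧ j₁ = j₁₃ + j₁₄))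
      (h₂ : n₂ = n₂₃ + n₂₄ ∧ (n₂ = 0 → i₂ = i₂₃ + i₂₄ ∧ j₂ = j₂₃ + j₂₄))
      (h₃ : n₃ = n₁₃ + n₂₃ ∧ (n₃ = 0 → i₃ = i₁₃ + i₂₃ ∧ j₃ = j₁₃ + j₂₃))
      (h₄ : n₄ = n₁₄ + n₂₄ ∧ (n₄ = 0 → i₄ = i₁₄ + i₂₄ ∧ j₄ = j₁₄ + j₂₄)) :
      ∃ x y z w : M12, elt n₁ i₁ j₁ = x + y ∧ elt n₂ i₂ j₂ = z + w ∧
        elt n₃ i₃ j₃ = x + z ∧ elt n₄ i₄ j₄ = y + w := by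
    refine ⟨elt n₁₃ i₁₃ j₁₃, elt n₁₄ i₁₄ j₁₄, elt n₂₃ i₂₃ j₂₃, elt n₂₄ i₂₄ j₂₄, ?_⟩
    simp only [elt_add, elt_eq_iff]
    exact ⟨h₁, h₂, h₃, h₄⟩
  obtain hn | hn := Nat.eq_zero_or_pos (n₁ + n₂)
  · apply key 0 (min i₁ i₃) (min j₁ j₃) 0 (i₁ - i₃) (j₁ - j₃) 0 (i₃ - i₁) (j₃ - j₁)
      0 (i₂ - (i₃ - i₁)) (j₂ - (j₃ - j₁)) <;> omega
  by_cases h₁ : n₁ = 0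
  · by_cases h₃ : n₃ = 0
    · apply key 0 0 0 0 i₁ j₁ 0 i₃ j₃ n₂ 0 0 <;> omega
    by_cases h₄ : n₄ = 0
    · apply key 0 i₁ j₁ 0 0 0 n₂ 0 0 0 i₄ j₄ <;> omega
    · apply key 0 i₁ j₁ 0 0 0 n₃ 0 0 n₄ 0 0 <;> omega
  by_cases h₂ : n₂ = 0
  · by_cases h₃ : n₃ = 0
    · apply key 0 i₃ j₃ n₁ 0 0 0 0 0 0 i₂ j₂ <;> omega
    by_cases h₄ : n₄ = 0
    · apply key n₁ 0 0 0 i₄ j₄ 0 i₂ j₂ 0 0 0 <;> omega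
    · apply key n₃ 0 0 n₄ 0 0 0 i₂ j₂ 0 0 0 <;> omega
  by_cases h₃ : n₃ = 0
  · apply key 0 i₃ j₃ n₁ 0 0 0 0 0 n₂ 0 0 <;> omega
  by_cases h₄ : n₄ = 0
  · apply key n₁ 0 0 0 i₄ j₄ n₂ 0 0 0 0 0 <;> omega
  · apply key (min n₁ n₃) 0 0 (n₁ - n₃) 0 0 (n₃ - n₁) 0 0 (n₂ - (n₃ - n₁)) 0 0 <;> omega

theorem exists_finset_closure_eq_top :
    ∃ S : Finset M12, AddSubmonoid.closure (S : Set M12) = ⊤ := by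
  classical
  refine ⟨Finset.univ.image gen, (AddSubmonoid.eq_top_iff' _).2 fun x => ?_⟩
  obtain ⟨n, i, j, rfl⟩ := exists_elt x
  have h (k : Fin 3) : gen k ∈ AddSubmonoid.closure (↑(Finset.univ.image gen) : Set M12) :=
    AddSubmonoid.subset_closure (by simp)
  exact add_mem (add_mem (nsmul_mem (h 0) n) (nsmul_mem (h 1) i)) (nsmul_mem (h 2) j)

/-- The coefficients of `a` and `b` in an element without `p`; zero on other elements. -/
def coeffs (x : M12) : ℕ × ℕ := ((coords x).1.toNat, (coords x).2.toNat)

theorem coeffs_elt_zero (i j : ℕ) : coeffs (elt 0 i j) = (i, j) := by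
  simp [coeffs, coords_elt_zero]

theorem coeffs_add {x y : M12} (hx : level x = 0) (hy : level y = 0) :
    coeffs (x + y) = coeffs x + coeffs y := by
  obtain ⟨n, i, j, rfl⟩ := exists_elt x
  obtain ⟨n', i', j', rfl⟩ := exists_elt y
  obtain rfl : n = 0 := by simpa using hx
  obtain rfl : n' = 0 := by simpa using hy
  simp [elt_add, coeffs_elt_zero]

end M12

namespace RowFiniteQuiver

variable (Q : RowFiniteQuiver) (val : Multiset Q.V →+ M12)

open scoped Classical in
/-- Replace each vertex whose value does not involve `p` by the coefficients of its value. -/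
noncomputable def collapse : Multiset Q.V →+ Multiset Q.V × ℕ × ℕ :=
  multisetHom fun v => if M12.level (val {v}) = 0 then (0, M12.coeffs (val {v})) else ({v}, 0)

theorem collapse_of_level_eq_zero {x : Multiset Q.V} (hx : M12.level (val x) = 0) :
    Q.collapse val x = (0, M12.coeffs (val x)) := by
  induction x using Multiset.induction_on with
  | empty => simp [M12.coeffs, Prod.ext_iff]
  | cons v x ih =>
    rw [← Multiset.singleton_add, map_add, map_add, Nat.add_eq_zero_iff] at hx
    rw [← Multiset.singleton_add, map_add, map_add, M12.coeffs_add hx.1 hx.2, ih hx.2]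
    simp [collapse, hx.1]

open scoped Classical in
/-- Apply the defining relations simultaneously to all vertices left over by `collapse`. -/
noncomputable def step : Multiset Q.V × ℕ × ℕ →+ Multiset Q.V × ℕ × ℕ :=
  (multisetHom fun v => if ∃ e, Q.s e = v then
    Q.collapse val ((Q.rowFinite v).toFinset.val.map Q.r) else ({v}, 0)).coprod
  (AddMonoidHom.inr _ _)

theorem iterate_step_inr (m : ℕ) (k : ℕ × ℕ) : (Q.step val)^[m] (0, k) = (0, k) :=
  Function.iterate_fixed (by simp [step]) m

theorem iterate_step_add_inr (m : ℕ) (w : Multiset Q.V × ℕ × ℕ) (k : ℕ × ℕ) :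
    (Q.step val)^[m] (w + (0, k)) = (Q.step val)^[m] w + (0, k) := by
  rw [iterate_map_add, iterate_step_inr]

theorem monotone_iterate_step_snd (w : Multiset Q.V × ℕ × ℕ) :
    Monotone fun m => ((Q.step val)^[m] w).2 := by
  refine monotone_nat_of_le_succ fun m => ?_
  rw [Function.iterate_succ_apply']
  simp [step]

/-- Two multisets of vertices of the same value are identified if that value involves `p`
at least twice or if their collapses have a common iterate under `step`. -/
def joinCon : AddCon (Multiset Q.V) where
  r x y := val x = val y ∧ (M12.level (val x) ≤ 1 →
    ∃ m n, (Q.step val)^[m] (Q.collapse val x) = (Q.step val)^[n] (Q.collapse val y))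
  iseqv := by
    refine ⟨fun x => ⟨rfl, fun _ => ⟨0, 0, rfl⟩⟩, ?_, ?_⟩
    · rintro x y ⟨h, h'⟩
      refine ⟨h.symm, fun hy => ?_⟩
      obtain ⟨m, n, hmn⟩ := h' (h ▸ hy)
      exact ⟨n, m, hmn.symm⟩
    · rintro x y z ⟨hxy, hxy'⟩ ⟨hyz, hyz'⟩
      refine ⟨hxy.trans hyz, fun hx => ?_⟩
      obtain ⟨m, n, hmn⟩ := hxy' hx
      obtain ⟨k, l, hkl⟩ := hyz' (hxy ▸ hx)
      refine ⟨k + m, n + l, ?_⟩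
      rw [Function.iterate_add_apply, hmn, Function.iterate_add_apply, ← hkl,
        ← Function.iterate_add_apply, ← Function.iterate_add_apply, add_comm]
  add' := by
    have aux {x x' y y' : Multiset Q.V} (hy : val y = val y') (h0 : M12.level (val y) = 0)
        (h : ∃ m n, (Q.step val)^[m] (Q.collapse val x) =
          (Q.step val)^[n] (Q.collapse val x')) :
        ∃ m n, (Q.step val)^[m] (Q.collapse val (x + y)) =
          (Q.step val)^[n] (Q.collapse val (x' + y')) := by
      obtain ⟨m, n, hmn⟩ := h
      refine ⟨m, n, ?_⟩
      have h0' : M12.level (val y') = 0 := hy ▸ h0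
      rw [map_add, map_add, Q.collapse_of_level_eq_zero val h0,
        Q.collapse_of_level_eq_zero val h0', iterate_step_add_inr, iterate_step_add_inr,
        hmn, hy]
    rintro w x y z ⟨hwx, hwx'⟩ ⟨hyz, hyz'⟩
    refine ⟨by rw [map_add, map_add, hwx, hyz], fun h => ?_⟩
    rw [map_add, map_add] at h
    obtain h0 | h0 : M12.level (val y) = 0 ∨ M12.level (val w) = 0 := by omega
    · exact aux hyz h0 (hwx' (by omega))
    · rw [add_comm w, add_comm x]
      exact aux hwx h0 (hyz' (by omega))

theorem addConGen_graphRel_le_joinCon (hval : ∀ x y, graphRel Q x y → val x = val y) :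
    addConGen (graphRel Q) ≤ Q.joinCon val := by
  refine AddCon.addConGen_le.2 fun x y h => ⟨hval x y h, fun _ => ?_⟩
  by_cases h0 : M12.level (val x) = 0
  · refine ⟨0, 0, ?_⟩
    rw [Q.collapse_of_level_eq_zero val h0,
      Q.collapse_of_level_eq_zero val (hval x y h ▸ h0), hval x y h]
  · obtain ⟨v, hv, rfl, rfl⟩ := h
    refine ⟨1, 0, ?_⟩
    have hc : Q.collapse val {v} = ({v}, 0) := by simp [collapse, h0]
    simp [hc, step, hv]

theorem exists_period {w : Multiset Q.V × ℕ × ℕ} {k : ℕ × ℕ} (hk : k ≠ 0)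
    (h : ∃ m n, (Q.step val)^[m] w = (Q.step val)^[n] (w + (0, k))) :
    ∃ d n, 0 < d ∧ ∀ N, n ≤ N → ∀ t : ℕ,
      (Q.step val)^[N + t * d] w = (Q.step val)^[N] w + (0, t • k) := by
  obtain ⟨m, n, h⟩ := h
  rw [iterate_step_add_inr] at h
  have hnm : n < m := by
    by_contra! hmn
    have hle := Q.monotone_iterate_step_snd val w hmn
    simp only [h, Prod.snd_add] at hle
    exact hk (by simpa using hle)
  obtain ⟨d, rfl⟩ := Nat.exists_eq_add_of_lt hnm
  refine ⟨d + 1, n, by omega, fun N hN t => ?_⟩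
  induction t with
  | zero => simp [← Prod.zero_eq_mk]
  | succ t ih =>
    obtain ⟨r, rfl⟩ := Nat.exists_eq_add_of_le hN
    have e : n + r + (t + 1) * (d + 1) = (r + t * (d + 1)) + (n + d + 1) := by ring
    have e' : (r + t * (d + 1)) + n = n + r + t * (d + 1) := by ring
    rw [e, Function.iterate_add_apply, h, iterate_step_add_inr, ← Function.iterate_add_apply,
      e', ih, add_assoc, succ_nsmul]
    simp

theorem not_nonempty_addEquiv : ¬ Nonempty (M12 ≃+ GraphMonoid Q) := by
  rintro ⟨φ⟩
  let val : Multiset Q.V →+ M12 := φ.symm.toAddMonoidHom.comp (addConGen (graphRel Q)).mk'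
  have hsurj (y : M12) : ∃ x, val x = y :=
    φ.symm.surjective.comp Quot.mk_surjective y
  have hrel (x y) (h : val x = val y) : Q.joinCon val x y := by
    refine Q.addConGen_graphRel_le_joinCon val (fun x y h => ?_) ((AddCon.eq _).1
      (φ.symm.injective h))
    exact congrArg φ.symm ((AddCon.eq _).2 (AddConGen.Rel.of x y h))
  obtain ⟨p, hp⟩ := hsurj (M12.elt 1 0 0)
  have key (i j : ℕ) (hij : (i, j) ≠ 0) : ∃ d n, 0 < d ∧ ∀ N, n ≤ N → ∀ t : ℕ,
      (Q.step val)^[N + t * d] (Q.collapse val p) =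
        (Q.step val)^[N] (Q.collapse val p) + (0, t • (i, j)) := by
    obtain ⟨c, hc⟩ := hsurj (M12.elt 0 i j)
    have h := (hrel p (p + c) (by
      rw [map_add, hp, hc, M12.elt_add, M12.elt_eq_iff]; omega)).2 (by simp [hp])
    rw [map_add, Q.collapse_of_level_eq_zero val (x := c) (by simp [hc]), hc,
      M12.coeffs_elt_zero] at h
    exact Q.exists_period val hij h
  obtain ⟨d₁, n₁, hd₁, h₁⟩ := key 1 0 (by simp)
  obtain ⟨d₂, n₂, hd₂, h₂⟩ := key 0 1 (by simp)
  have h := (h₁ (n₁ + n₂) (by omega) d₂).symm.trans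
    ((mul_comm d₂ d₁ ▸ h₂ (n₁ + n₂) (by omega) d₁))
  have h' := add_left_cancel h
  simp at h'
  omega

end RowFiniteQuiver

/-- The monoid `M = ⟨p, a, b ∣ p = p + a = p + b⟩` is a finitely generated
primitive monoid which is not isomorphic to the graph monoid of any row-finite
quiver. -/
theorem statement12 :
    (∃ S : Finset M12, AddSubmonoid.closure (S : Set M12) = ⊤) ∧
    IsPrimitive M12 ∧
    ¬ ∃ Q : RowFiniteQuiver, Nonempty (M12 ≃+ GraphMonoid Q) := by
  exact ⟨M12.exists_finset_closure_eq_top,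
    ⟨M12.isAntisymmetric, M12.primelyGenerated, M12.isRefinement⟩,
    fun ⟨Q, h⟩ => Q.not_nonempty_addEquiv h⟩
end
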